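/- arXiv:2108.00314 — 10 statements merged into one kernel-verified Lean document; each statement's English description precedes it below -/
import Mathlib

section
/- Let (X,d) be a metric space, R : X^n → X a voting rule, and ε > 0, and consider a deliberation process whose winner never changes, i.e. w^j = w^0 for all j. Then for every agent i and every iteration j, d(v_i^j, w^0) = max(0, d(v_i^0, w^0) − j·ε). Consequently, letting D = max_i d(v_i^0, w^0), all agents are at w^0 from iteration ⌈D/ε⌉ onward, and if D > 0 then at every iteration j < ⌈D/ε⌉ some agent is not at w^0; i.e. the process converges to the consensus w^0 after exactly ⌈D/ε⌉ iterations. -/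
/-- A deliberation process: at each iteration `j`, every agent `i` moves from `V j i`
to `V (j+1) i`, subject to constraints (C1) and (C2) with respect to the current
winner `R (V j)` and step size `ε`. -/
def DelibProcess {X : Type*} {n : ℕ} (d : X → X → ℝ) (R : (Fin n → X) → X) (ε : ℝ)
    (V : ℕ → Fin n → X) : Prop :=
  ∀ (i : Fin n) (j : ℕ),
    d (V (j + 1) i) (R (V j)) = max 0 (d (V j i) (R (V j)) - ε) ∧
    (0 < d (V (j + 1) i) (R (V j)) → d (V (j + 1) i) (V j i) = ε) ∧
    (d (V (j + 1) i) (R (V j)) = 0 → d (V (j + 1) i) (V j i) ≤ ε)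

/-- The process converges: from some iteration on, the profile never changes. -/
def Converges {X : Type*} {n : ℕ} (V : ℕ → Fin n → X) : Prop :=
  ∃ N : ℕ, ∀ j : ℕ, N ≤ j → V j = V N
/-- If the winner never changes, then each agent's distance to the winner at iteration
j is exactly max(0, d(v_i^0, w^0) − j·ε); with D the maximal initial distance to the
winner, all agents are at w^0 from iteration ⌈D/ε⌉ on, and if D > 0 then before
iteration ⌈D/ε⌉ some agent is not at w^0. -/
theorem stmt2 {X : Type*} [MetricSpace X] {n : ℕ} (hn : 0 < n)
    (R : (Fin n → X) → X) {ε : ℝ} (hε : 0 < ε)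
    (V : ℕ → Fin n → X) (hV : DelibProcess dist R ε V)
    (hw : ∀ j : ℕ, R (V j) = R (V 0))
    (D : ℝ)
    (hD : D = Finset.univ.sup'
      (Finset.univ_nonempty_iff.mpr (Fin.pos_iff_nonempty.mp hn))
      (fun i : Fin n => dist (V 0 i) (R (V 0)))) :
    (∀ (i : Fin n) (j : ℕ),
      dist (V j i) (R (V 0)) = max 0 (dist (V 0 i) (R (V 0)) - j * ε)) ∧
    (∀ j : ℕ, ⌈D / ε⌉₊ ≤ j → ∀ i : Fin n, V j i = R (V 0)) ∧
    (0 < D → ∀ j : ℕ, j < ⌈D / ε⌉₊ → ∃ i : Fin n, V j i ≠ R (V 0)) := by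
  have hdist : ∀ (i : Fin n) (j : ℕ),
      dist (V j i) (R (V 0)) = max 0 (dist (V 0 i) (R (V 0)) - j * ε) := by
    intro i j
    induction j with
    | zero => simp
    | succ j ih =>
      have h := (hV i j).1
      rw [hw j, ih] at h
      rw [h]
      push_cast
      rcases le_total 0 (dist (V 0 i) (R (V 0)) - j * ε) with h0 | h0
      · rw [max_eq_right h0]
        congr 1
        ring
      · rw [max_eq_left h0, max_eq_left (by linarith), max_eq_left (by linarith)]
  refine ⟨hdist, fun j hj i => ?_, fun _ j hj => ?_⟩
  · have hDj : D ≤ j * ε := (div_le_iff₀ hε).mp (Nat.ceil_le.mp hj)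
    have hi : dist (V 0 i) (R (V 0)) ≤ D := by
      rw [hD]
      exact Finset.le_sup' (fun i : Fin n => dist (V 0 i) (R (V 0))) (Finset.mem_univ i)
    rw [← dist_eq_zero, hdist i j]
    exact max_eq_left (by linarith)
  · have hDj : j * ε < D := (lt_div_iff₀ hε).mp (Nat.lt_ceil.mp hj)
    obtain ⟨i, -, hi⟩ := Finset.exists_mem_eq_sup'
      (Finset.univ_nonempty_iff.mpr (Fin.pos_iff_nonempty.mp hn))
      (fun i : Fin n => dist (V 0 i) (R (V 0)))
    refine ⟨i, dist_pos.mp ?_⟩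
    rw [hdist i j]
    exact lt_max_of_lt_right (by linarith)
end

section
/- Let (X,d) be a metric space, ε > 0, and let V = (v_0, …, v_{n-1}) ∈ X^n. Suppose w ∈ X minimizes the sum of distances to V, i.e. Σ_i d(v_i, w) ≤ Σ_i d(v_i, x) for all x ∈ X. If V' = (v'_0, …, v'_{n-1}) ∈ X^n satisfies, for every i, d(v'_i, w) = max(0, d(v_i, w) − ε) and d(v'_i, v_i) ≤ ε, then w also minimizes the sum of distances to V': Σ_i d(v'_i, w) ≤ Σ_i d(v'_i, x) for all x ∈ X. -/
/-- If `w` minimizes the sum of distances to the profile `V`, and `V'` is obtained from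
`V` by one deliberation step towards `w` (each agent moves ε closer to `w`, moving by at
most ε), then `w` also minimizes the sum of distances to `V'`. -/
theorem stmt3 {X : Type*} [MetricSpace X] {n : ℕ} {ε : ℝ} (hε : 0 < ε)
    (V V' : Fin n → X) (w : X)
    (hw : ∀ x : X, ∑ i : Fin n, dist (V i) w ≤ ∑ i : Fin n, dist (V i) x)
    (h1 : ∀ i : Fin n, dist (V' i) w = max 0 (dist (V i) w - ε))
    (h2 : ∀ i : Fin n, dist (V' i) (V i) ≤ ε) :
    ∀ x : X, ∑ i : Fin n, dist (V' i) w ≤ ∑ i : Fin n, dist (V' i) x := by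
  intro x
  have key : ∀ i, dist (V' i) w + dist (V i) x ≤ dist (V' i) x + dist (V i) w := by
    intro i
    rcases le_total ε (dist (V i) w) with h | h
    · have hd := h1 i
      rw [max_eq_right (sub_nonneg.2 h)] at hd
      linarith [dist_triangle_left (V i) x (V' i), h2 i]
    · have hd := h1 i
      rw [max_eq_left (sub_nonpos.2 h)] at hd
      rw [dist_eq_zero.1 hd, dist_self]
      linarith [dist_triangle (V i) w x]
  have hsum := Finset.sum_le_sum fun i (_ : i ∈ Finset.univ) => key i
  simp only [Finset.sum_add_distrib] at hsum
  linarith [hw x]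
end

section
/- Let (X,d) be a metric space, ε > 0, and let R : X^n → X be a voting rule such that for every profile U = (u_0, …, u_{n-1}) ∈ X^n, the point R(U) is the unique minimizer over X of x ↦ Σ_i d(u_i, x). Then in every deliberation process the winner is invariant, w^j = w^0 for all j, and the process converges: all agents are at w^0 after exactly max_i ⌈d(v_i^0, w^0)/ε⌉ iterations. -/
/-- In one iteration of a deliberation process, every agent moves along a geodesic towards the
winner. -/
theorem DelibProcess.dist_add_dist {X : Type*} [MetricSpace X] {n : ℕ}
    {R : (Fin n → X) → X} {ε : ℝ} {V : ℕ → Fin n → X} (hV : DelibProcess dist R ε V)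
    (i : Fin n) (j : ℕ) :
    dist (V j i) (V (j + 1) i) + dist (V (j + 1) i) (R (V j)) = dist (V j i) (R (V j)) := by
  obtain ⟨h1, h2, -⟩ := hV i j
  rcases (dist_nonneg (x := V (j + 1) i) (y := R (V j))).eq_or_lt with h | h
  · rw [← h, dist_eq_zero.mp h.symm, add_zero]
  · rw [dist_comm (V j i) (V (j + 1) i), h2 h]
    rcases max_choice 0 (dist (V j i) (R (V j)) - ε) with hm | hm <;> linarith

/-- If the voting rule picks the unique minimizer of the sum of distances, then the winner does
not change in one iteration. -/
theorem DelibProcess.winner_succ {X : Type*} [MetricSpace X] {n : ℕ}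
    {R : (Fin n → X) → X} {ε : ℝ} {V : ℕ → Fin n → X} (hV : DelibProcess dist R ε V)
    (hR : ∀ (U : Fin n → X) (x : X), x ≠ R U →
      ∑ i : Fin n, dist (U i) (R U) < ∑ i : Fin n, dist (U i) x) (j : ℕ) :
    R (V (j + 1)) = R (V j) := by
  by_contra hne
  have hnew := hR (V (j + 1)) (R (V j)) (Ne.symm hne)
  have hold := hR (V j) (R (V (j + 1))) hne
  have htri : ∑ i, dist (V j i) (R (V (j + 1))) ≤
      ∑ i, (dist (V j i) (V (j + 1) i) + dist (V (j + 1) i) (R (V (j + 1)))) :=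
    Finset.sum_le_sum fun i _ => dist_triangle _ _ _
  have hgeo : ∑ i, (dist (V j i) (V (j + 1) i) + dist (V (j + 1) i) (R (V j))) =
      ∑ i, dist (V j i) (R (V j)) :=
    Finset.sum_congr rfl fun i _ => hV.dist_add_dist i j
  rw [Finset.sum_add_distrib] at htri hgeo
  linarith

/-- If the winner is invariant, then after `j` iterations the distance of every agent to it has
dropped by `j * ε`, truncated at zero. -/
theorem DelibProcess.dist_winner {X : Type*} [MetricSpace X] {n : ℕ}
    {R : (Fin n → X) → X} {ε : ℝ} (hε : 0 < ε) {V : ℕ → Fin n → X}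
    (hV : DelibProcess dist R ε V) (hw : ∀ j, R (V j) = R (V 0)) (i : Fin n) (j : ℕ) :
    dist (V j i) (R (V 0)) = max 0 (dist (V 0 i) (R (V 0)) - j * ε) := by
  induction j with
  | zero => simp
  | succ j ih =>
    have h := (hV i j).1
    rw [hw j, ih] at h
    rw [h]
    push_cast
    grind

/-- If the voting rule R always returns the unique minimizer of the sum of distances
to the profile, then in every deliberation process the winner is invariant, and the
process converges to the consensus w^0 after exactly max_i ⌈d(v_i^0, w^0)/ε⌉
iterations. -/
theorem stmt4 {X : Type*} [MetricSpace X] {n : ℕ}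
    (R : (Fin n → X) → X) {ε : ℝ} (hε : 0 < ε)
    (hR : ∀ (U : Fin n → X) (x : X), x ≠ R U →
      ∑ i : Fin n, dist (U i) (R U) < ∑ i : Fin n, dist (U i) x)
    (V : ℕ → Fin n → X) (hV : DelibProcess dist R ε V) :
    (∀ j : ℕ, R (V j) = R (V 0)) ∧
    (∀ j : ℕ, (Finset.univ.sup fun i : Fin n => ⌈dist (V 0 i) (R (V 0)) / ε⌉₊) ≤ j →
      ∀ i : Fin n, V j i = R (V 0)) ∧
    (∀ j : ℕ, j < (Finset.univ.sup fun i : Fin n => ⌈dist (V 0 i) (R (V 0)) / ε⌉₊) →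
      ∃ i : Fin n, V j i ≠ R (V 0)) ∧
    Converges V := by
  have hw : ∀ j, R (V j) = R (V 0) := fun j => by
    induction j with
    | zero => rfl
    | succ j ih => rw [hV.winner_succ hR j, ih]
  have hiff : ∀ i j, V j i = R (V 0) ↔ ⌈dist (V 0 i) (R (V 0)) / ε⌉₊ ≤ j := fun i j => by
    rw [← dist_eq_zero, hV.dist_winner hε hw, max_eq_left_iff, sub_nonpos, Nat.ceil_le,
      div_le_iff₀ hε]
  have hall : ∀ j, (Finset.univ.sup fun i : Fin n => ⌈dist (V 0 i) (R (V 0)) / ε⌉₊) ≤ j →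
      ∀ i : Fin n, V j i = R (V 0) := fun j hj i =>
    (hiff i j).2 (Finset.sup_le_iff.1 hj i (Finset.mem_univ i))
  refine ⟨hw, hall, fun j hj => ?_, _, fun j hj => funext fun i =>
    (hall j hj i).trans (hall _ le_rfl i).symm⟩
  obtain ⟨i, -, hi⟩ := Finset.lt_sup_iff.1 hj
  exact ⟨i, fun h => hi.not_ge ((hiff i j).1 h)⟩
end

section
/- Let T ≥ 1, let d be the ℓ1 metric on ℝ^T, and let ε > 0. Suppose v, v', w ∈ ℝ^T satisfy d(v', w) = max(0, d(v, w) − ε) and d(v', v) ≤ ε. Then for every coordinate t ∈ {1,…,T}, the value v'_t lies between v_t and w_t; i.e., either w_t ≤ v'_t ≤ v_t or v_t ≤ v'_t ≤ w_t. -/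
/-- The ℓ1 distance on ℝ^T. -/
def l1dist {T : ℕ} (x y : Fin T → ℝ) : ℝ := ∑ t : Fin T, |x t - y t|

/-- Equality in the ℓ1 triangle inequality forces coordinatewise betweenness. -/
theorem between_of_l1dist_add_le {T : ℕ} {x y z : Fin T → ℝ}
    (h : l1dist y z + l1dist y x ≤ l1dist x z) (t : Fin T) :
    (z t ≤ y t ∧ y t ≤ x t) ∨ (x t ≤ y t ∧ y t ≤ z t) := by
  have hle : ∀ i ∈ Finset.univ, |x i - z i| ≤ |y i - z i| + |y i - x i| := fun i _ => by
    rw [abs_sub_comm (y i) (x i), add_comm]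
    exact abs_sub_le _ _ _
  have heq : ∑ i, |x i - z i| = ∑ i, (|y i - z i| + |y i - x i|) := by
    refine le_antisymm (Finset.sum_le_sum hle) ?_
    simpa only [l1dist, Finset.sum_add_distrib] using h
  have ht := (Finset.sum_eq_sum_iff_of_le hle).1 heq t (Finset.mem_univ t)
  grind

/-- Points at ℓ1 distance at most zero agree. -/
theorem eq_of_l1dist_le_zero {T : ℕ} {x y : Fin T → ℝ} (h : l1dist x y ≤ 0) : x = y := by
  funext t
  have ht := Finset.single_le_sum (f := fun i => |x i - y i|)
    (fun i _ => abs_nonneg _) (Finset.mem_univ t)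
  exact sub_eq_zero.1 (abs_nonpos_iff.1 (ht.trans h))

/-- In ℝ^T with the ℓ1 metric, if v' satisfies the one-step deliberation constraints
(moving from v towards the winner w with step size ε), then in every coordinate t,
v'_t lies between v_t and w_t. -/
theorem stmt5 {T : ℕ} (hT : 1 ≤ T) {ε : ℝ} (hε : 0 < ε) (v v' w : Fin T → ℝ)
    (h1 : l1dist v' w = max 0 (l1dist v w - ε))
    (h2 : l1dist v' v ≤ ε) :
    ∀ t : Fin T, (w t ≤ v' t ∧ v' t ≤ v t) ∨ (v t ≤ v' t ∧ v' t ≤ w t) := by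
  rcases le_total (l1dist v w - ε) 0 with h | h
  · rw [max_eq_left h] at h1
    intro t
    rw [eq_of_l1dist_le_zero h1.le]
    grind
  · rw [max_eq_right h] at h1
    exact between_of_l1dist_add_le (by linarith)
end

section
/- Let T ≥ 1, n ≥ 1, X = ℝ^T with the ℓ1 metric, and let R be the element-wise mean rule. Then for every ε > 0, every deliberation process converges. -/
/-- The element-wise mean rule on ℝ^T. -/
noncomputable def meanRule {T n : ℕ} (V : Fin n → Fin T → ℝ) : Fin T → ℝ :=
  fun t => (∑ i : Fin n, V i t) / (n : ℝ)

theorem l1dist_nonneg {T : ℕ} (x y : Fin T → ℝ) : 0 ≤ l1dist x y :=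
  Finset.sum_nonneg fun _ _ => abs_nonneg _

theorem eq_of_l1dist_eq_zero {T : ℕ} {x y : Fin T → ℝ} (h : l1dist x y = 0) : x = y := by
  funext t
  have := (Finset.sum_eq_zero_iff_of_nonneg fun _ _ => abs_nonneg _).1 h t (Finset.mem_univ t)
  exact sub_eq_zero.1 (abs_eq_zero.1 this)

theorem meanRule_const {T n : ℕ} (hn : 1 ≤ n) (c : Fin T → ℝ) :
    meanRule (fun _ : Fin n => c) = c := by
  have hn0 : (n : ℝ) ≠ 0 := by positivity
  funext t
  simp [meanRule, hn0]

/-- The mean minimizes the sum of squared deviations. -/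
theorem sum_sq_sub_mean_le {n : ℕ} (hn : 1 ≤ n) (a : Fin n → ℝ) (c : ℝ) :
    ∑ i, (a i - (∑ k, a k) / n) ^ 2 ≤ ∑ i, (a i - c) ^ 2 := by
  have hn0 : (n : ℝ) ≠ 0 := by positivity
  set m : ℝ := (∑ k, a k) / n with hm
  have hS : ∑ k, a k = n * m := by rw [hm]; field_simp
  have key : ∑ i, (a i - c) ^ 2 = ∑ i, (a i - m) ^ 2 + n * (m - c) ^ 2 := by
    have expand (b : ℝ) : ∑ i, (a i - b) ^ 2 = ∑ i, a i ^ 2 - 2 * b * (n * m) + n * b ^ 2 := by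
      simp only [sub_sq, Finset.sum_add_distrib, Finset.sum_sub_distrib, ← Finset.sum_mul,
        ← Finset.mul_sum, hS]
      simp
      ring
    rw [expand c, expand m]
    ring
  rw [key]
  have : 0 ≤ (n : ℝ) * (m - c) ^ 2 := by positivity
  linarith

/-- Moving along an `ℓ1` geodesic towards `w` decreases the sum of squares by at least the
sum of the squared coordinate displacements. -/
theorem sum_sq_add_le_of_l1dist_add_eq {T : ℕ} {x y w : Fin T → ℝ}
    (h : l1dist y x + l1dist y w = l1dist x w) :
    ∑ t, (y t - w t) ^ 2 + ∑ t, |y t - x t| ^ 2 ≤ ∑ t, (x t - w t) ^ 2 := by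
  have tri (t : Fin T) : |x t - w t| ≤ |y t - x t| + |y t - w t| := by
    rw [abs_sub_comm (y t)]
    exact abs_sub_le _ _ _
  have hsum : ∑ t, |x t - w t| = ∑ t, (|y t - x t| + |y t - w t|) := by
    rw [Finset.sum_add_distrib]
    exact h.symm
  have heq := (Finset.sum_eq_sum_iff_of_le fun t _ => tri t).1 hsum
  rw [← Finset.sum_add_distrib]
  refine Finset.sum_le_sum fun t ht => ?_
  rw [← sq_abs (x t - w t), ← sq_abs (y t - w t), heq t ht]
  nlinarith [mul_nonneg (abs_nonneg (y t - x t)) (abs_nonneg (y t - w t))]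

/-- The sum of squared deviations of a profile from its mean. -/
noncomputable def meanDeviation {T n : ℕ} (V : Fin n → Fin T → ℝ) : ℝ :=
  ∑ i, ∑ t, (V i t - meanRule V t) ^ 2

theorem meanDeviation_nonneg {T n : ℕ} (V : Fin n → Fin T → ℝ) : 0 ≤ meanDeviation V := by
  unfold meanDeviation
  positivity

theorem meanDeviation_le {T n : ℕ} (hn : 1 ≤ n) (V : Fin n → Fin T → ℝ) (c : Fin T → ℝ) :
    meanDeviation V ≤ ∑ i, ∑ t, (V i t - c t) ^ 2 := by
  unfold meanDeviation
  rw [Finset.sum_comm, Finset.sum_comm (f := fun i t => (V i t - c t) ^ 2)]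
  exact Finset.sum_le_sum fun t _ => sum_sq_sub_mean_le hn (fun i => V i t) (c t)

namespace DelibProcess

variable {T n : ℕ} {ε : ℝ} {V : ℕ → Fin n → Fin T → ℝ}

theorem eq_mean_of_le (hV : DelibProcess l1dist meanRule ε V) {i : Fin n} {j : ℕ}
    (h : l1dist (V j i) (meanRule (V j)) ≤ ε) : V (j + 1) i = meanRule (V j) := by
  apply eq_of_l1dist_eq_zero
  rw [(hV i j).1, max_eq_left (by linarith)]

theorem sum_sq_add_le_of_lt (hV : DelibProcess l1dist meanRule ε V) (hT : 1 ≤ T)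
    {i : Fin n} {j : ℕ} (h : ε < l1dist (V j i) (meanRule (V j))) :
    ∑ t, (V (j + 1) i t - meanRule (V j) t) ^ 2 + ε ^ 2 / T
      ≤ ∑ t, (V j i t - meanRule (V j) t) ^ 2 := by
  obtain ⟨h1, h2, -⟩ := hV i j
  rw [max_eq_right (by linarith)] at h1
  have hstep := h2 (by linarith)
  have hdec := sum_sq_add_le_of_l1dist_add_eq (by linarith :
    l1dist (V (j + 1) i) (V j i) + l1dist (V (j + 1) i) (meanRule (V j))
      = l1dist (V j i) (meanRule (V j)))
  have hcs := sq_sum_le_card_mul_sum_sq (s := (Finset.univ : Finset (Fin T)))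
    (f := fun t => |V (j + 1) i t - V j i t|)
  rw [show ∑ t, |V (j + 1) i t - V j i t| = ε from hstep, Finset.card_univ,
    Fintype.card_fin] at hcs
  have hT0 : (0 : ℝ) < T := by positivity
  have : ε ^ 2 / T ≤ ∑ t, |V (j + 1) i t - V j i t| ^ 2 := by
    rw [div_le_iff₀ hT0]
    linarith
  linarith

theorem sum_sq_le (hV : DelibProcess l1dist meanRule ε V) (hT : 1 ≤ T)
    (i : Fin n) (j : ℕ) :
    ∑ t, (V (j + 1) i t - meanRule (V j) t) ^ 2 ≤ ∑ t, (V j i t - meanRule (V j) t) ^ 2 := by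
  rcases le_or_gt (l1dist (V j i) (meanRule (V j))) ε with h | h
  · simp only [hV.eq_mean_of_le h, sub_self, ne_eq, OfNat.ofNat_ne_zero, not_false_eq_true,
      zero_pow, Finset.sum_const_zero]
    positivity
  · have : 0 ≤ ε ^ 2 / T := by positivity
    linarith [hV.sum_sq_add_le_of_lt hT h]

theorem meanDeviation_succ_add_le (hV : DelibProcess l1dist meanRule ε V) (hT : 1 ≤ T)
    (hn : 1 ≤ n) {i : Fin n} {j : ℕ}
    (h : ε < l1dist (V j i) (meanRule (V j))) :
    meanDeviation (V (j + 1)) + ε ^ 2 / T ≤ meanDeviation (V j) := by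
  have hle := meanDeviation_le hn (V (j + 1)) (meanRule (V j))
  have hrest := Finset.sum_le_sum fun k (_ : k ∈ Finset.univ.erase i) => hV.sum_sq_le hT k j
  have hi := hV.sum_sq_add_le_of_lt hT h
  rw [← Finset.add_sum_erase _ _ (Finset.mem_univ i)] at hle
  change _ ≤ ∑ k, ∑ t, (V j k t - meanRule (V j) t) ^ 2
  rw [← Finset.add_sum_erase _ _ (Finset.mem_univ i)]
  linarith

theorem exists_forall_l1dist_le (hV : DelibProcess l1dist meanRule ε V) (hT : 1 ≤ T)
    (hn : 1 ≤ n) (hε : 0 < ε) : ∃ j, ∀ i, l1dist (V j i) (meanRule (V j)) ≤ ε := by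
  by_contra! hfar
  have hbound (j : ℕ) : meanDeviation (V j) + j * (ε ^ 2 / T) ≤ meanDeviation (V 0) := by
    induction j with
    | zero => simp
    | succ j ih =>
      obtain ⟨i, hi⟩ := hfar j
      have := hV.meanDeviation_succ_add_le hT hn hi
      push_cast
      linarith
  have hpos : 0 < ε ^ 2 / T := by positivity
  obtain ⟨j, hj⟩ := Archimedean.arch (meanDeviation (V 0) + 1) hpos
  rw [nsmul_eq_mul] at hj
  linarith [hbound j, meanDeviation_nonneg (V j)]

end DelibProcess

/-- On ℝ^T with the ℓ1 metric and the element-wise mean rule, every deliberation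
process converges. -/
theorem stmt6 {T n : ℕ} (hT : 1 ≤ T) (hn : 1 ≤ n) {ε : ℝ} (hε : 0 < ε)
    (V : ℕ → Fin n → (Fin T → ℝ)) (hV : DelibProcess l1dist meanRule ε V) :
    Converges V := by
  obtain ⟨j, hj⟩ := hV.exists_forall_l1dist_le hT hn hε
  have hconst (k : ℕ) (hk : j + 1 ≤ k) : V k = fun _ => meanRule (V j) := by
    induction k, hk using Nat.le_induction with
    | base => exact funext fun i => hV.eq_mean_of_le (hj i)
    | succ k _ ih =>
      have hmean : meanRule (V k) = meanRule (V j) := by rw [ih, meanRule_const hn]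
      funext i
      rw [← hmean]
      apply hV.eq_mean_of_le
      rw [hmean, ih]
      simpa [l1dist] using hε.le
  exact ⟨j + 1, fun k hk => by rw [hconst k hk, hconst (j + 1) le_rfl]⟩
end

section
/- Consider a deliberation process on X = ℝ^T with the ℓ2 (Euclidean) metric, R the element-wise mean rule, and any ε > 0. Then for every iteration j, every closed Euclidean ball that contains all agent positions v_0^j, …, v_{n-1}^j also contains all positions v_0^{j+1}, …, v_{n-1}^{j+1}. Consequently, if the process converges to a consensus point c, then c lies in every closed Euclidean ball containing all initial ideal points v_0^0, …, v_{n-1}^0 (in particular, in the smallest enclosing ball of the initial profile). -/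
/-- The ℓ2 (Euclidean) distance on ℝ^T. -/
noncomputable def l2dist {T : ℕ} (x y : Fin T → ℝ) : ℝ :=
  Real.sqrt (∑ t : Fin T, (x t - y t) ^ 2)

theorem l2dist_eq_dist {T : ℕ} (x y : Fin T → ℝ) :
    l2dist x y = dist (WithLp.toLp 2 x) (WithLp.toLp 2 y) := by
  simp [l2dist, EuclideanSpace.dist_eq, Real.dist_eq, sq_abs]

theorem meanRule_mem_convex {T n : ℕ} (hn : 1 ≤ n) {s : Set (EuclideanSpace ℝ (Fin T))}
    (hs : Convex ℝ s) (v : Fin n → Fin T → ℝ) (hv : ∀ i, WithLp.toLp 2 (v i) ∈ s) :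
    WithLp.toLp 2 (meanRule v) ∈ s := by
  have hn' : (n : ℝ) ≠ 0 := by positivity
  have h : WithLp.toLp 2 (meanRule v) = ∑ i, (n : ℝ)⁻¹ • WithLp.toLp 2 (v i) := by
    ext t
    simp [meanRule, ← Finset.mul_sum, div_eq_inv_mul]
  rw [h]
  exact hs.sum_mem (fun _ _ => by positivity) (by simp [hn']) fun i _ => hv i

/-- Each agent of a deliberation process with the Euclidean metric moves along the segment from
its position to the winner. -/
theorem DelibProcess.mem_segment {T n : ℕ} {ε : ℝ} {R : (Fin n → Fin T → ℝ) → Fin T → ℝ}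
    {V : ℕ → Fin n → Fin T → ℝ} (hV : DelibProcess l2dist R ε V) (j : ℕ) (i : Fin n) :
    WithLp.toLp 2 (V (j + 1) i) ∈
      segment ℝ (WithLp.toLp 2 (V j i) : EuclideanSpace ℝ (Fin T))
        (WithLp.toLp 2 (R (V j))) := by
  obtain ⟨h₁, h₂, -⟩ := hV i j
  simp only [l2dist_eq_dist] at h₁ h₂
  rcases (dist_nonneg (x := WithLp.toLp 2 (V (j + 1) i))
    (y := WithLp.toLp 2 (R (V j)))).eq_or_lt' with h | h
  · rw [dist_eq_zero.mp h]
    exact right_mem_segment ℝ _ _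
  · rw [mem_segment_iff_wbtw, ← dist_add_dist_eq_iff, dist_comm (WithLp.toLp 2 (V j i)), h₂ h, h₁]
    have hpos : 0 < dist (WithLp.toLp 2 (V j i)) (WithLp.toLp 2 (R (V j))) - ε := by
      rw [h₁] at h
      exact (lt_max_iff.mp h).resolve_left (lt_irrefl 0)
    rw [max_eq_right hpos.le]
    ring

theorem DelibProcess.closedBall_step {T n : ℕ} (hn : 1 ≤ n) {ε : ℝ} {V : ℕ → Fin n → Fin T → ℝ}
    (hV : DelibProcess l2dist meanRule ε V) (j : ℕ) (c : Fin T → ℝ) (r : ℝ)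
    (h : ∀ i, l2dist (V j i) c ≤ r) (i : Fin n) : l2dist (V (j + 1) i) c ≤ r := by
  simp only [l2dist_eq_dist, ← Metric.mem_closedBall] at h ⊢
  have hs := convex_closedBall (WithLp.toLp 2 c : EuclideanSpace ℝ (Fin T)) r
  exact hs.segment_subset (h i) (meanRule_mem_convex hn hs (V j) h) (hV.mem_segment j i)

/-- On ℝ^T with the ℓ2 metric and the element-wise mean rule: every closed ball that
contains all agent positions at iteration j also contains all positions at iteration
j + 1; consequently, if the process converges to a consensus point c, then c lies in
every closed ball containing all initial ideal points. -/
theorem stmt9 {T n : ℕ} (hn : 1 ≤ n) {ε : ℝ} (hε : 0 < ε)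
    (V : ℕ → Fin n → (Fin T → ℝ)) (hV : DelibProcess l2dist meanRule ε V) :
    (∀ (j : ℕ) (c : Fin T → ℝ) (r : ℝ),
      (∀ i : Fin n, l2dist (V j i) c ≤ r) → ∀ i : Fin n, l2dist (V (j + 1) i) c ≤ r) ∧
    (∀ c : Fin T → ℝ, (∃ N : ℕ, ∀ j : ℕ, N ≤ j → ∀ i : Fin n, V j i = c) →
      ∀ (c₀ : Fin T → ℝ) (r : ℝ),
        (∀ i : Fin n, l2dist (V 0 i) c₀ ≤ r) → l2dist c c₀ ≤ r) := by
  refine ⟨hV.closedBall_step hn, ?_⟩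
  rintro c ⟨N, hN⟩ c₀ r h₀
  have h : ∀ j i, l2dist (V j i) c₀ ≤ r := fun j =>
    Nat.rec h₀ (fun k hk => hV.closedBall_step hn k c₀ r hk) j
  simpa [hN N le_rfl] using h N ⟨0, hn⟩
end

section
/- Let T ≥ 1, n ≥ 1, X = ℝ^T with the ℓ1 metric, and let R be the element-wise median rule. Then for every ε > 0, in every deliberation process the winner is invariant, w^j = w^0 for all j, and the process converges to the consensus w^0 after exactly max_i ⌈d(v_i^0, w^0)/ε⌉ iterations. -/
/-- The ℓ1 distance on ℝ^T. -/
def ldist {T : ℕ} (x y : Fin T → ℝ) : ℝ := ∑ t : Fin T, |x t - y t|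

/-- The median of n real numbers: the middle value in sorted (ascending) order, where
for an even number of values we take the larger of the two middle values; i.e., the
value at 0-indexed position ⌊n/2⌋ of the ascending sorted list. -/
noncomputable def medianVal {n : ℕ} (f : Fin n → ℝ) : ℝ :=
  ((Multiset.ofList (List.ofFn f)).sort (· ≤ ·)).getD (n / 2) 0

/-- The element-wise median rule on ℝ^T. -/
noncomputable def medianRule {T n : ℕ} (V : Fin n → Fin T → ℝ) : Fin T → ℝ :=
  fun t => medianVal (fun i : Fin n => V i t)

theorem exists_perm_monotone_medianVal {n : ℕ} (hn : 1 ≤ n) (f : Fin n → ℝ) :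
    ∃ σ : Equiv.Perm (Fin n), Monotone (f ∘ σ) ∧
      medianVal f = f (σ ⟨n / 2, by omega⟩) := by
  refine ⟨Tuple.sort f, Tuple.monotone_sort f, ?_⟩
  have hsort : (Multiset.ofList (List.ofFn f)).sort (· ≤ ·) =
      List.ofFn (f ∘ Tuple.sort f) := by
    refine List.Perm.eq_of_pairwise' (r := (· ≤ ·)) (Multiset.pairwise_sort _ _)
      (Tuple.monotone_sort f).sortedLE_ofFn.pairwise ?_
    rw [← Multiset.coe_eq_coe, Multiset.sort_eq, Multiset.coe_eq_coe]
    exact (Equiv.Perm.ofFn_comp_perm _ f).symm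
  have hlt : n / 2 < n := by omega
  rw [medianVal, hsort, List.getD_eq_getElem _ _ (by simpa using hlt), List.getElem_ofFn]
  rfl

theorem half_lt_card_le_medianVal {n : ℕ} (hn : 1 ≤ n) (f : Fin n → ℝ) :
    n / 2 < (Finset.univ.filter fun i => f i ≤ medianVal f).card := by
  obtain ⟨σ, hσ, hm⟩ := exists_perm_monotone_medianVal hn f
  have hsub : (Finset.Iic (⟨n / 2, by omega⟩ : Fin n)).map σ.toEmbedding ⊆
      Finset.univ.filter fun i => f i ≤ medianVal f := by
    intro i hi
    obtain ⟨k, hk, rfl⟩ := Finset.mem_map.1 hi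
    simpa [hm] using hσ (Finset.mem_Iic.1 hk)
  have hcard := Finset.card_le_card hsub
  rw [Finset.card_map, Fin.card_Iic] at hcard
  exact hcard

theorem sub_half_le_card_medianVal_le {n : ℕ} (hn : 1 ≤ n) (f : Fin n → ℝ) :
    n - n / 2 ≤ (Finset.univ.filter fun i => medianVal f ≤ f i).card := by
  obtain ⟨σ, hσ, hm⟩ := exists_perm_monotone_medianVal hn f
  have hsub : (Finset.Ici (⟨n / 2, by omega⟩ : Fin n)).map σ.toEmbedding ⊆
      Finset.univ.filter fun i => medianVal f ≤ f i := by
    intro i hi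
    obtain ⟨k, hk, rfl⟩ := Finset.mem_map.1 hi
    simpa [hm] using hσ (Finset.mem_Ici.1 hk)
  have hcard := Finset.card_le_card hsub
  rw [Finset.card_map, Fin.card_Ici] at hcard
  exact hcard

/-- The median is unchanged when no value crosses it. -/
theorem medianVal_eq_of_forall {n : ℕ} (hn : 1 ≤ n) (f g : Fin n → ℝ)
    (hle : ∀ i, f i ≤ medianVal f → g i ≤ medianVal f)
    (hge : ∀ i, medianVal f ≤ f i → medianVal f ≤ g i) :
    medianVal g = medianVal f := by
  have not_both : ∀ a b : ℝ, a < b → n / 2 < (Finset.univ.filter fun i => g i ≤ a).card →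
      n - n / 2 ≤ (Finset.univ.filter fun i => b ≤ g i).card → False := by
    intro a b hab ha hb
    have hdisj : Disjoint (Finset.univ.filter fun i => g i ≤ a)
        (Finset.univ.filter fun i => b ≤ g i) := by
      rw [Finset.disjoint_filter]
      intro i _ h₁ h₂
      linarith
    have hcard := Finset.card_le_univ
      ((Finset.univ.filter fun i => g i ≤ a).disjUnion
        (Finset.univ.filter fun i => b ≤ g i) hdisj)
    rw [Finset.card_disjUnion, Fintype.card_fin] at hcard
    omega
  have hlow : n / 2 < (Finset.univ.filter fun i => g i ≤ medianVal f).card :=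
    (half_lt_card_le_medianVal hn f).trans_le
      (Finset.card_le_card (Finset.monotone_filter_right _ fun i _ => hle i))
  have hhigh : n - n / 2 ≤ (Finset.univ.filter fun i => medianVal f ≤ g i).card :=
    (sub_half_le_card_medianVal_le hn f).trans
      (Finset.card_le_card (Finset.monotone_filter_right _ fun i _ => hge i))
  rcases lt_trichotomy (medianVal g) (medianVal f) with h | h | h
  · exact (not_both _ _ h (half_lt_card_le_medianVal hn g) hhigh).elim
  · exact h
  · exact (not_both _ _ h hlow (sub_half_le_card_medianVal_le hn g)).elim

theorem ldist_nonneg {T : ℕ} (x y : Fin T → ℝ) : 0 ≤ ldist x y :=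
  Finset.sum_nonneg fun _ _ => abs_nonneg _

theorem ldist_eq_zero_iff {T : ℕ} {x y : Fin T → ℝ} : ldist x y = 0 ↔ x = y := by
  rw [ldist, Finset.sum_eq_zero_iff_of_nonneg fun _ _ => abs_nonneg _, funext_iff]
  simp [sub_eq_zero]

/-- A point on an `ℓ1` geodesic from `x` to `z` is coordinatewise between `x` and `z`. -/
theorem abs_add_abs_eq_of_ldist_add_eq {T : ℕ} {x y z : Fin T → ℝ}
    (h : ldist y x + ldist y z ≤ ldist x z) (t : Fin T) :
    |y t - x t| + |y t - z t| = |x t - z t| := by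
  have htri : ∀ s ∈ Finset.univ, |x s - z s| ≤ |y s - x s| + |y s - z s| := fun s _ => by
    rw [abs_sub_comm (y s) (x s)]
    exact abs_sub_le _ _ _
  have hsum : ∑ s, |x s - z s| = ∑ s, (|y s - x s| + |y s - z s|) := by
    refine le_antisymm (Finset.sum_le_sum htri) ?_
    rw [Finset.sum_add_distrib]
    exact h
  exact ((Finset.sum_eq_sum_iff_of_le htri).1 hsum t (Finset.mem_univ t)).symm

theorem DelibProcess.ldist_add_le {T n : ℕ} {ε : ℝ}
    {R : (Fin n → Fin T → ℝ) → Fin T → ℝ} {V : ℕ → Fin n → Fin T → ℝ}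
    (hV : DelibProcess ldist R ε V) (i : Fin n) (j : ℕ) :
    ldist (V (j + 1) i) (V j i) + ldist (V (j + 1) i) (R (V j)) ≤
      ldist (V j i) (R (V j)) := by
  obtain ⟨h₁, h₂, -⟩ := hV i j
  rcases (ldist_nonneg (V (j + 1) i) (R (V j))).eq_or_lt with h | h
  · have heq := ldist_eq_zero_iff.1 h.symm
    have hcomm : ldist (R (V j)) (V j i) = ldist (V j i) (R (V j)) :=
      Finset.sum_congr rfl fun t _ => abs_sub_comm _ _
    rw [← h, heq, hcomm, add_zero]
  · rw [h₂ h]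
    rcases max_choice 0 (ldist (V j i) (R (V j)) - ε) with hm | hm <;> linarith

theorem DelibProcess.medianRule_succ {T n : ℕ} (hn : 1 ≤ n) {ε : ℝ}
    {V : ℕ → Fin n → Fin T → ℝ} (hV : DelibProcess ldist medianRule ε V) (j : ℕ) :
    medianRule (V (j + 1)) = medianRule (V j) := by
  funext t
  refine medianVal_eq_of_forall hn (fun i => V j i t) (fun i => V (j + 1) i t) ?_ ?_
  all_goals
    intro i hi
    have h := abs_add_abs_eq_of_ldist_add_eq (hV.ldist_add_le i j) t
    simp only [medianRule] at h
    grind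

theorem DelibProcess.ldist_eq_max {T n : ℕ} {ε : ℝ} (hε : 0 ≤ ε)
    {R : (Fin n → Fin T → ℝ) → Fin T → ℝ} {V : ℕ → Fin n → Fin T → ℝ}
    (hV : DelibProcess ldist R ε V) (hR : ∀ j, R (V j) = R (V 0)) (i : Fin n) (j : ℕ) :
    ldist (V j i) (R (V 0)) = max 0 (ldist (V 0 i) (R (V 0)) - j * ε) := by
  induction j with
  | zero => simp [ldist_nonneg]
  | succ j ih =>
    have h := (hV i j).1
    rw [hR j, ih] at h
    rw [h]
    push_cast
    grind

/-- On ℝ^T with the ℓ1 metric and the element-wise median rule: in every deliberation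
process the winner is invariant, and the process converges to the consensus w^0 after
exactly max_i ⌈d(v_i^0, w^0)/ε⌉ iterations. -/
theorem stmt10 {T n : ℕ} (hT : 1 ≤ T) (hn : 1 ≤ n) {ε : ℝ} (hε : 0 < ε)
    (V : ℕ → Fin n → (Fin T → ℝ)) (hV : DelibProcess ldist medianRule ε V) :
    (∀ j : ℕ, medianRule (V j) = medianRule (V 0)) ∧
    (∀ j : ℕ,
      (Finset.univ.sup fun i : Fin n => ⌈ldist (V 0 i) (medianRule (V 0)) / ε⌉₊) ≤ j →
      ∀ i : Fin n, V j i = medianRule (V 0)) ∧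
    (∀ j : ℕ,
      j < (Finset.univ.sup fun i : Fin n => ⌈ldist (V 0 i) (medianRule (V 0)) / ε⌉₊) →
      ∃ i : Fin n, V j i ≠ medianRule (V 0)) ∧
    Converges V := by
  have hR : ∀ j : ℕ, medianRule (V j) = medianRule (V 0) := by
    intro j
    induction j with
    | zero => rfl
    | succ j ih => rw [hV.medianRule_succ hn, ih]
  have hiff : ∀ (j : ℕ) (i : Fin n), V j i = medianRule (V 0) ↔
      ⌈ldist (V 0 i) (medianRule (V 0)) / ε⌉₊ ≤ j := by
    intro j i
    rw [← ldist_eq_zero_iff, hV.ldist_eq_max hε.le hR, Nat.ceil_le, div_le_iff₀ hε,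
      max_eq_left_iff, sub_nonpos]
  have hcons : ∀ j : ℕ,
      (Finset.univ.sup fun i : Fin n => ⌈ldist (V 0 i) (medianRule (V 0)) / ε⌉₊) ≤ j →
      ∀ i : Fin n, V j i = medianRule (V 0) := fun j hj i =>
    (hiff j i).2 (Finset.sup_le_iff.1 hj i (Finset.mem_univ i))
  refine ⟨hR, hcons, fun j hj => ?_,
    Finset.univ.sup fun i : Fin n => ⌈ldist (V 0 i) (medianRule (V 0)) / ε⌉₊,
    fun j hj => funext fun i => ?_⟩
  · obtain ⟨i, -, hi⟩ := Finset.lt_sup_iff.1 hj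
    exact ⟨i, fun h => hi.not_ge ((hiff j i).1 h)⟩
  · rw [hcons j hj i, hcons _ le_rfl i]
end

section
/- Let m ≥ 1, let X = {0,1}^m with the Hamming distance, let ε be a positive integer, and let R : X^n → X be a monotonic VNW rule. Then in every deliberation process the winner is invariant, w^j = w^0 for all j, and the process converges to the consensus w^0 after exactly max_i ⌈d(v_i^0, w^0)/ε⌉ iterations; in particular convergence is guaranteed. -/
/-- A VNW (variable number of winners) rule is monotonic if, whenever a single agent
flips a single coordinate so that it agrees with the current winner on that
coordinate (i.e., flips a 1 to 0 at a position where the winner has a 0, or a 0 to 1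
at a position where the winner has a 1), the winner stays the same. -/
def VNWMonotonic {m n : ℕ} (R : (Fin n → (Fin m → Bool)) → (Fin m → Bool)) : Prop :=
  ∀ (V V' : Fin n → (Fin m → Bool)) (i : Fin n) (t : Fin m),
    (∀ i' : Fin n, i' ≠ i → V' i' = V i') →
    (∀ t' : Fin m, t' ≠ t → V' i t' = V i t') →
    V i t ≠ R V t → V' i t = R V t →
    R V' = R V

/-- A point on a Hamming geodesic from `x` to `w` agrees with `x` or `w` in each coordinate. -/
theorem eq_or_eq_of_hammingDist_add_le {ι : Type*} [Fintype ι] {β : ι → Type*}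
    [∀ i, DecidableEq (β i)] {x z w : ∀ i, β i}
    (h : hammingDist z x + hammingDist z w ≤ hammingDist x w) (t : ι) :
    z t = x t ∨ z t = w t := by
  classical
  by_contra! hc
  have hsub : Finset.univ.filter (fun i => x i ≠ w i) ⊆
      Finset.univ.filter (fun i => z i ≠ x i) ∪ Finset.univ.filter (fun i => z i ≠ w i) := by
    intro i
    simp only [Finset.mem_union, Finset.mem_filter, Finset.mem_univ, true_and]
    grind
  have hinter : 0 < (Finset.univ.filter (fun i => z i ≠ x i) ∩
      Finset.univ.filter (fun i => z i ≠ w i)).card :=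
    Finset.card_pos.mpr ⟨t, by simp [hc.1, hc.2]⟩
  have hcard := Finset.card_le_card hsub
  have hunion := Finset.card_union_add_card_inter (Finset.univ.filter (fun i => z i ≠ x i))
    (Finset.univ.filter (fun i => z i ≠ w i))
  simp only [hammingDist] at h
  omega

/-- Under a monotonic rule, moving any agents towards the winner keeps the winner. -/
theorem VNWMonotonic.winner_eq {m n : ℕ} {R : (Fin n → (Fin m → Bool)) → (Fin m → Bool)}
    (hR : VNWMonotonic R) {V V' : Fin n → (Fin m → Bool)}
    (h : ∀ i t, V' i t = V i t ∨ V' i t = R V t) : R V' = R V := by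
  classical
  have key : ∀ S : Finset (Fin n × Fin m),
      R (fun i t => if (i, t) ∈ S then V' i t else V i t) = R V := by
    intro S
    induction S using Finset.induction_on with
    | empty => simp
    | insert p S hp ih =>
      obtain ⟨i, t⟩ := p
      by_cases hit : V' i t = V i t
      · rw [← ih]
        congr 1
        funext i' t'
        by_cases hp' : (i', t') = (i, t)
        · simp only [Prod.mk.injEq] at hp'
          obtain ⟨rfl, rfl⟩ := hp'
          simp [hit]
        · simp [Finset.mem_insert, hp']
      · have hw := (h i t).resolve_left hit
        refine Eq.trans (hR _ _ i t ?_ ?_ ?_ ?_) ih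
        · intro i' hi'
          funext t'
          simp [Finset.mem_insert, hi']
        · intro t' ht'
          simp [Finset.mem_insert, ht']
        · rw [ih, ← hw]
          simpa [hp] using Ne.symm hit
        · rw [ih]
          simpa using hw
  simpa using key Finset.univ

section Dynamics

variable {m n ε : ℕ} {R : (Fin n → (Fin m → Bool)) → (Fin m → Bool)}
  {V : ℕ → Fin n → (Fin m → Bool)}

theorem DelibProcess.hammingDist_succ
    (hV : DelibProcess (fun x y => (hammingDist x y : ℝ)) R (ε : ℝ) V) (i : Fin n) (j : ℕ) :
    hammingDist (V (j + 1) i) (R (V j)) = hammingDist (V j i) (R (V j)) - ε := by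
  have h : (hammingDist (V (j + 1) i) (R (V j)) : ℝ) =
      max 0 ((hammingDist (V j i) (R (V j)) : ℝ) - ε) := (hV i j).1
  rcases le_total ε (hammingDist (V j i) (R (V j))) with hle | hle
  · have hle' : (ε : ℝ) ≤ hammingDist (V j i) (R (V j)) := by exact_mod_cast hle
    rw [max_eq_right (sub_nonneg.mpr hle')] at h
    exact_mod_cast h.trans (Nat.cast_sub hle).symm
  · have hle' : (hammingDist (V j i) (R (V j)) : ℝ) ≤ ε := by exact_mod_cast hle
    rw [max_eq_left (sub_nonpos.mpr hle')] at h
    rw [Nat.sub_eq_zero_of_le hle]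
    exact_mod_cast h

theorem DelibProcess.winner_succ_s14
    (hV : DelibProcess (fun x y => (hammingDist x y : ℝ)) R (ε : ℝ) V)
    (hR : VNWMonotonic R) (j : ℕ) : R (V (j + 1)) = R (V j) := by
  refine hR.winner_eq fun i t => ?_
  have hd := hV.hammingDist_succ i j
  rcases Nat.eq_zero_or_pos (hammingDist (V (j + 1) i) (R (V j))) with h0 | hpos
  · exact Or.inr (congrFun (hammingDist_eq_zero.mp h0) t)
  · have hstep : (hammingDist (V (j + 1) i) (V j i) : ℝ) = ε :=
      (hV i j).2.1 (Nat.cast_pos.mpr hpos)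
    have hstep' : hammingDist (V (j + 1) i) (V j i) = ε := by exact_mod_cast hstep
    exact eq_or_eq_of_hammingDist_add_le (by omega) t

theorem DelibProcess.winner_eq
    (hV : DelibProcess (fun x y => (hammingDist x y : ℝ)) R (ε : ℝ) V)
    (hR : VNWMonotonic R) (j : ℕ) : R (V j) = R (V 0) := by
  induction j with
  | zero => rfl
  | succ j ih => rw [hV.winner_succ_s14 hR, ih]

theorem DelibProcess.hammingDist_eq
    (hV : DelibProcess (fun x y => (hammingDist x y : ℝ)) R (ε : ℝ) V)
    (hR : VNWMonotonic R) (i : Fin n) (j : ℕ) :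
    hammingDist (V j i) (R (V 0)) = hammingDist (V 0 i) (R (V 0)) - j * ε := by
  induction j with
  | zero => simp
  | succ j ih =>
    have h := hV.hammingDist_succ i j
    rw [hV.winner_eq hR j, ih] at h
    rw [h, Nat.sub_sub, Nat.succ_mul]

/-- An agent has reached the initial winner by time `j` iff `j` is at least its ceiling bound. -/
theorem DelibProcess.eq_winner_iff
    (hV : DelibProcess (fun x y => (hammingDist x y : ℝ)) R (ε : ℝ) V)
    (hR : VNWMonotonic R) (hε : 1 ≤ ε) (i : Fin n) (j : ℕ) :
    V j i = R (V 0) ↔ ⌈(hammingDist (V 0 i) (R (V 0)) : ℝ) / (ε : ℝ)⌉₊ ≤ j := by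
  have hε' : (0 : ℝ) < ε := by exact_mod_cast hε
  rw [← hammingDist_eq_zero, hV.hammingDist_eq hR, Nat.sub_eq_zero_iff_le, Nat.ceil_le,
    div_le_iff₀ hε']
  exact_mod_cast Iff.rfl

end Dynamics

/-- On the hypercube {0,1}^m with the Hamming distance and a monotonic VNW rule: in
every deliberation process (integer ε ≥ 1) the winner is invariant, and the process
converges to the consensus w^0 after exactly max_i ⌈d(v_i^0, w^0)/ε⌉ iterations. -/
theorem stmt14 {m n : ℕ} (hm : 1 ≤ m) {ε : ℕ} (hε : 1 ≤ ε)
    (R : (Fin n → (Fin m → Bool)) → (Fin m → Bool)) (hR : VNWMonotonic R)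
    (V : ℕ → Fin n → (Fin m → Bool))
    (hV : DelibProcess (fun x y => (hammingDist x y : ℝ)) R (ε : ℝ) V) :
    (∀ j : ℕ, R (V j) = R (V 0)) ∧
    (∀ j : ℕ,
      (Finset.univ.sup fun i : Fin n =>
        ⌈(hammingDist (V 0 i) (R (V 0)) : ℝ) / (ε : ℝ)⌉₊) ≤ j →
      ∀ i : Fin n, V j i = R (V 0)) ∧
    (∀ j : ℕ,
      j < (Finset.univ.sup fun i : Fin n =>
        ⌈(hammingDist (V 0 i) (R (V 0)) : ℝ) / (ε : ℝ)⌉₊) →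
      ∃ i : Fin n, V j i ≠ R (V 0)) ∧
    Converges V := by
  have hcons : ∀ j : ℕ,
      (Finset.univ.sup fun i : Fin n =>
        ⌈(hammingDist (V 0 i) (R (V 0)) : ℝ) / (ε : ℝ)⌉₊) ≤ j → ∀ i : Fin n, V j i = R (V 0) :=
    fun j hj i => (hV.eq_winner_iff hR hε i j).mpr (Finset.sup_le_iff.mp hj i (Finset.mem_univ i))
  refine ⟨hV.winner_eq hR, hcons, fun j hj => ?_, ⟨_, fun j hj => funext fun i =>
    (hcons j hj i).trans (hcons _ le_rfl i).symm⟩⟩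
  obtain ⟨i, -, hi⟩ := Finset.lt_sup_iff.mp hj
  exact ⟨i, fun h => absurd ((hV.eq_winner_iff hR hε i j).mp h) (not_le.mpr hi)⟩
end

section
/- Let X be the set of rankings of m candidates with the swap distance, let ε be a positive integer, and let R : X^n → X be a monotonic scoring rule (with score function f and fixed tie-breaking order O). Then every deliberation process converges. -/
/-- The swap (Kendall tau) distance between two rankings: the number of (unordered)
pairs of candidates ranked in opposite relative order by the two rankings. Each
discordant pair {a, b} is counted exactly once, as the ordered pair (a, b) with
σ ranking a above b (smaller position) and τ ranking b above a. -/
def swapDist {m : ℕ} (σ τ : Equiv.Perm (Fin m)) : ℕ :=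
  (Finset.univ.filter fun p : Fin m × Fin m => σ p.1 < σ p.2 ∧ τ p.2 < τ p.1).card

theorem Monotone.eventually_const_of_finite_range {α : Type*} [PartialOrder α] {g : ℕ → α}
    (hg : Monotone g) (hfin : (Set.range g).Finite) : ∃ N, ∀ j, N ≤ j → g j = g N := by
  obtain ⟨x, hx⟩ := hfin.exists_maximal (Set.range_nonempty g)
  obtain ⟨N, rfl⟩ := hx.prop
  exact ⟨N, fun j hj => (hx.eq_of_le ⟨j, rfl⟩ (hg hj)).symm⟩

theorem val_eq_card_above {m : ℕ} (σ : Equiv.Perm (Fin m)) (c : Fin m) :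
    (σ c : ℕ) = (Finset.univ.filter fun a => σ a < σ c).card := by
  rw [← Fin.card_Iio (σ c), ← Finset.card_map (s := Finset.univ.filter _) σ.toEmbedding]
  congr 1
  ext x
  simp only [Finset.mem_Iio, Finset.mem_map, Finset.mem_filter, Finset.mem_univ, true_and,
    Equiv.coe_toEmbedding]
  exact ⟨fun h => ⟨σ.symm x, by simpa using h, by simp⟩, fun ⟨a, ha, hax⟩ => hax ▸ ha⟩

theorem position_le_of_above_imp {m : ℕ} {σ τ : Equiv.Perm (Fin m)} {c : Fin m}
    (h : ∀ a, σ a < σ c → τ a < τ c) : σ c ≤ τ c := by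
  rw [Fin.le_def, val_eq_card_above, val_eq_card_above]
  exact Finset.card_le_card fun a => by simpa using h a

theorem swapDist_comm {m : ℕ} (σ τ : Equiv.Perm (Fin m)) : swapDist σ τ = swapDist τ σ := by
  unfold swapDist
  rw [← Finset.card_map (Equiv.prodComm (Fin m) (Fin m)).toEmbedding]
  congr 1
  ext ⟨a, b⟩
  simp [and_comm]

theorem not_discordant_of_swapDist_eq_zero {m : ℕ} {σ τ : Equiv.Perm (Fin m)}
    (h : swapDist σ τ = 0) {a b : Fin m} (hab : σ a < σ b) : ¬ τ b < τ a := by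
  intro hτ
  rw [swapDist, Finset.card_eq_zero, Finset.filter_eq_empty_iff] at h
  exact h (Finset.mem_univ (a, b)) ⟨hab, hτ⟩

/-- A ranking lying on a geodesic from `σ` to `w` keeps every comparison shared by `σ` and `w`. -/
theorem lt_of_swapDist_add_le {m : ℕ} {σ σ' w : Equiv.Perm (Fin m)}
    (h : swapDist σ' w + swapDist σ' σ ≤ swapDist σ w) {a b : Fin m}
    (hσ : σ a < σ b) (hw : w a < w b) : σ' a < σ' b := by
  by_contra hn
  have hne : a ≠ b := fun e => by simp [e] at hσ
  have hσ' : σ' b < σ' a := lt_of_le_of_ne (not_lt.mp hn) fun e => hne (σ'.injective e).symm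
  rw [swapDist_comm σ' σ] at h
  unfold swapDist at h
  have hnot : (b, a) ∉ Finset.univ.filter
      fun p : Fin m × Fin m => σ p.1 < σ p.2 ∧ w p.2 < w p.1 := by
    simp [hσ.le]
  have hsub := (Finset.card_le_card (s := insert (b, a) (Finset.univ.filter
      fun p : Fin m × Fin m => σ p.1 < σ p.2 ∧ w p.2 < w p.1))
      (t := (Finset.univ.filter fun p : Fin m × Fin m => σ' p.1 < σ' p.2 ∧ w p.2 < w p.1) ∪
        Finset.univ.filter fun p : Fin m × Fin m => σ p.1 < σ p.2 ∧ σ' p.2 < σ' p.1) (by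
      intro p hp
      simp only [Finset.mem_insert, Finset.mem_union, Finset.mem_filter, Finset.mem_univ,
        true_and] at hp ⊢
      rcases hp with rfl | ⟨h1, h2⟩
      · exact Or.inl ⟨hσ', hw⟩
      · rcases lt_trichotomy (σ' p.1) (σ' p.2) with h3 | h3 | h3
        · exact Or.inl ⟨h3, h2⟩
        · rw [σ'.injective h3] at h1
          exact absurd h1 (lt_irrefl _)
        · exact Or.inr ⟨h1, h3⟩)).trans (Finset.card_union_le _ _)
  rw [Finset.card_insert_of_notMem hnot] at hsub
  omega

/-- An agent never gives up a comparison on which it agrees with the current winner. -/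
theorem DelibProcess.lt_succ {m n ε : ℕ} {R : (Fin n → Equiv.Perm (Fin m)) → Equiv.Perm (Fin m)}
    {V : ℕ → Fin n → Equiv.Perm (Fin m)}
    (hV : DelibProcess (fun σ τ => (swapDist σ τ : ℝ)) R (ε : ℝ) V) {i : Fin n} {j : ℕ}
    {a b : Fin m} (hab : V j i a < V j i b) (hw : R (V j) a < R (V j) b) :
    V (j + 1) i a < V (j + 1) i b := by
  obtain ⟨h1, h2, -⟩ := hV i j
  rcases Nat.eq_zero_or_pos (swapDist (V (j + 1) i) (R (V j))) with h0 | hpos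
  · have hne : a ≠ b := fun e => by simp [e] at hab
    by_contra hn
    exact not_discordant_of_swapDist_eq_zero h0
      (lt_of_le_of_ne (not_lt.mp hn) fun e => hne ((V (j + 1) i).injective e).symm) hw
  · have hpos' : (0 : ℝ) < swapDist (V (j + 1) i) (R (V j)) := by exact_mod_cast hpos
    have h3 := h2 hpos'
    refine lt_of_swapDist_add_le ?_ hab hw
    have : (swapDist (V (j + 1) i) (R (V j)) : ℝ) + swapDist (V (j + 1) i) (V j i)
        ≤ swapDist (V j i) (R (V j)) := by
      rcases max_cases (0 : ℝ) (swapDist (V j i) (R (V j)) - ε) with h | h <;> linarith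
    exact_mod_cast this

/-- From iteration `N` on, the first `k` places of the winners `w` are fixed, and no agent changes
a comparison involving one of the candidates in those places. -/
def PrefixStable {m n : ℕ} (w : ℕ → Equiv.Perm (Fin m)) (V : ℕ → Fin n → Equiv.Perm (Fin m))
    (k N : ℕ) : Prop :=
  ∀ j, N ≤ j → ∀ a, (w N a : ℕ) < k →
    w j a = w N a ∧ ∀ i b, V j i b < V j i a ↔ V N i b < V N i a

theorem PrefixStable.lt_of_lt {m n : ℕ} {w : ℕ → Equiv.Perm (Fin m)}
    {V : ℕ → Fin n → Equiv.Perm (Fin m)} {k N : ℕ} (h : PrefixStable w V k N) {j : ℕ}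
    (hj : N ≤ j) {a : Fin m} (ha : (w j a : ℕ) < k) : (w N a : ℕ) < k := by
  have hc := (h j hj ((w N).symm (w j a)) (by simpa using ha)).1
  rw [Equiv.apply_symm_apply] at hc
  rw [← (w j).injective hc, Equiv.apply_symm_apply]
  exact ha

theorem PrefixStable.iff_succ {m n : ℕ} {w : ℕ → Equiv.Perm (Fin m)}
    {V : ℕ → Fin n → Equiv.Perm (Fin m)} {k N : ℕ} (h : PrefixStable w V k N) {j : ℕ}
    (hj : N ≤ j) {a : Fin m} (ha : (w j a : ℕ) < k) (i : Fin n) (b : Fin m) :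
    V (j + 1) i b < V (j + 1) i a ↔ V j i b < V j i a := by
  have ha' := h.lt_of_lt hj ha
  rw [(h (j + 1) (by omega) a ha').2 i b, (h j hj a ha').2 i b]

/-- Once the first `k` places are stable, only candidates already above the one in place `k`
can remain above it. -/
theorem PrefixStable.above_of_above_succ {m n ε : ℕ}
    {R : (Fin n → Equiv.Perm (Fin m)) → Equiv.Perm (Fin m)}
    {V : ℕ → Fin n → Equiv.Perm (Fin m)}
    (hV : DelibProcess (fun σ τ => (swapDist σ τ : ℝ)) R (ε : ℝ) V) {k N : ℕ}
    (h : PrefixStable (fun j => R (V j)) V k N) {j : ℕ} (hj : N ≤ j) {t : Fin m}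
    (ht : (R (V j) t : ℕ) = k) {i : Fin n} {a : Fin m}
    (ha : V (j + 1) i a < V (j + 1) i t) : V j i a < V j i t := by
  have hne : t ≠ a := fun e => by simp [e] at ha
  by_contra hn
  have hlt : V j i t < V j i a :=
    lt_of_le_of_ne (not_lt.mp hn) fun e => hne ((V j i).injective e)
  have hle : (R (V j) t : ℕ) ≤ R (V j) a := by
    by_contra hk
    exact lt_asymm ha ((h.iff_succ hj (by simpa [← ht] using hk) i t).mpr hlt)
  exact lt_asymm ha (hV.lt_succ hlt
    (lt_of_le_of_ne hle fun e => hne ((R (V j)).injective e)))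

theorem PrefixStable.exists_succ {m n ε : ℕ}
    {f : (Fin n → Equiv.Perm (Fin m)) → (Fin m → ℝ)} {O : Equiv.Perm (Fin m)}
    {R : (Fin n → Equiv.Perm (Fin m)) → Equiv.Perm (Fin m)}
    (hR : ∀ (U : Fin n → Equiv.Perm (Fin m)) (a b : Fin m),
      R U a < R U b ↔ (f U b < f U a ∨ (f U a = f U b ∧ O a < O b)))
    (hmono : ∀ (U U' : Fin n → Equiv.Perm (Fin m)) (c : Fin m),
      (∀ i : Fin n, U i c ≤ U' i c) → f U' c ≤ f U c)
    {V : ℕ → Fin n → Equiv.Perm (Fin m)}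
    (hV : DelibProcess (fun σ τ => (swapDist σ τ : ℝ)) R (ε : ℝ) V) {k N : ℕ} (hk : k < m)
    (h : PrefixStable (fun j => R (V j)) V k N) :
    ∃ N', PrefixStable (fun j => R (V j)) V (k + 1) N' := by
  let t : ℕ → Fin m := fun j => (R (V j)).symm ⟨k, hk⟩
  have ht : ∀ j, R (V j) (t j) = ⟨k, hk⟩ := fun j => by simp [t]
  let e : (Fin n → Equiv.Perm (Fin m)) × Fin m → ℝ ×ₗ (Fin m)ᵒᵈ :=
    fun p => toLex (f p.1 p.2, OrderDual.toDual (O p.2))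
  let g : ℕ → ℝ ×ₗ (Fin m)ᵒᵈ := fun j => e (V (N + j), t (N + j))
  have hg : Monotone g := by
    refine monotone_nat_of_le_succ fun j => ?_
    have hf : f (V (N + j)) (t (N + j)) ≤ f (V (N + j + 1)) (t (N + j)) :=
      hmono _ _ _ fun i => position_le_of_above_imp fun a ha =>
        h.above_of_above_succ hV (by omega) (by rw [ht]) ha
    have hplace : R (V (N + j + 1)) (t (N + j + 1)) ≤ R (V (N + j + 1)) (t (N + j)) := by
      rw [ht, Fin.le_def]
      by_contra hlt
      have hlt : (R (V (N + j + 1)) (t (N + j)) : ℕ) < k := by simpa using hlt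
      have h1 := h.lt_of_lt (j := N + j + 1) (by omega) hlt
      have h2 := (h (N + j) (by omega) _ h1).1
      simp only [ht] at h2
      rw [← h2] at h1
      simp at h1
    change e (V (N + j), t (N + j)) ≤ e (V (N + j + 1), t (N + j + 1))
    rw [Prod.Lex.le_iff]
    rcases hplace.lt_or_eq with hlt | heq
    · rcases (hR _ _ _).mp hlt with h1 | ⟨h1, h2⟩
      · exact Or.inl (lt_of_le_of_lt hf h1)
      · rcases hf.lt_or_eq with h3 | h3
        · exact Or.inl (h3.trans_eq h1.symm)
        · exact Or.inr ⟨h3.trans h1.symm, h2.le⟩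
    · rw [(R (V (N + j + 1))).injective heq]
      rcases hf.lt_or_eq with h3 | h3
      · exact Or.inl h3
      · exact Or.inr ⟨h3, le_rfl⟩
  obtain ⟨N₁, hN₁⟩ := hg.eventually_const_of_finite_range
    ((Set.finite_range e).subset (by rintro _ ⟨j, rfl⟩; exact ⟨_, rfl⟩))
  have htop : ∀ j, N + N₁ ≤ j → t j = t (N + N₁) := by
    intro j hj
    have h1 := congrArg (fun x => OrderDual.ofDual (ofLex x).2) (hN₁ (j - N) (by omega))
    rw [← O.injective.eq_iff]
    simpa [g, e, show N + (j - N) = j by omega] using h1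
  let S : ℕ → Fin n → (Set (Fin m))ᵒᵈ := fun j i => OrderDual.toDual
    {a | V (N + N₁ + j) i a < V (N + N₁ + j) i (t (N + N₁))}
  have hS : Monotone S := by
    refine monotone_nat_of_le_succ fun j i a ha => ?_
    exact h.above_of_above_succ hV (j := N + N₁ + j) (by omega)
      (by rw [← htop (N + N₁ + j) (by omega), ht]) ha
  obtain ⟨N₂, hN₂⟩ := hS.eventually_const_of_finite_range (Set.toFinite _)
  refine ⟨N + N₁ + N₂, fun j hj a ha => ?_⟩
  rcases Nat.lt_succ_iff_lt_or_eq.mp ha with ha | ha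
  · have ha' := h.lt_of_lt (j := N + N₁ + N₂) (by omega) ha
    obtain ⟨h1, h2⟩ := h j (by omega) a ha'
    obtain ⟨h3, h4⟩ := h (N + N₁ + N₂) (by omega) a ha'
    exact ⟨h1.trans h3.symm, fun i b => (h2 i b).trans (h4 i b).symm⟩
  · have hat : a = t (N + N₁) := by
      rw [← htop (N + N₁ + N₂) (by omega), Equiv.eq_symm_apply]
      exact Fin.ext ha
    subst hat
    refine ⟨?_, fun i b => ?_⟩
    · have h1 := ht j
      have h2 := ht (N + N₁ + N₂)
      rw [htop j (by omega)] at h1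
      rw [htop _ (by omega)] at h2
      exact h1.trans h2.symm
    · have h1 := congrFun (hN₂ (j - (N + N₁)) (by omega)) i
      have h2 := Set.ext_iff.mp (OrderDual.toDual.injective h1) b
      simpa [show N + N₁ + (j - (N + N₁)) = j by omega] using h2

/-- On the set of rankings of m candidates (bijections Fin m → Fin m, mapping each
candidate to its position; smaller position = ranked higher) with the swap distance,
and a monotonic scoring rule R (given by a score function f and a fixed tie-breaking
order O on the candidates: the winner ranks a above b iff a has a strictly larger
score, or equal score and a precedes b in O; and f is monotonic: if every agent ranks
c at least as high in U as in U', then f(U)[c] ≥ f(U')[c]): every deliberation process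
(integer ε ≥ 1) converges. -/
theorem stmt17 {m n : ℕ} {ε : ℕ} (hε : 1 ≤ ε)
    (f : (Fin n → Equiv.Perm (Fin m)) → (Fin m → ℝ))
    (O : Equiv.Perm (Fin m))
    (R : (Fin n → Equiv.Perm (Fin m)) → Equiv.Perm (Fin m))
    (hR : ∀ (U : Fin n → Equiv.Perm (Fin m)) (a b : Fin m),
      R U a < R U b ↔ (f U b < f U a ∨ (f U a = f U b ∧ O a < O b)))
    (hmono : ∀ (U U' : Fin n → Equiv.Perm (Fin m)) (c : Fin m),
      (∀ i : Fin n, U i c ≤ U' i c) → f U' c ≤ f U c)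
    (V : ℕ → Fin n → Equiv.Perm (Fin m))
    (hV : DelibProcess (fun σ τ => (swapDist σ τ : ℝ)) R (ε : ℝ) V) :
    Converges V := by
  have hstab : ∀ k, k ≤ m → ∃ N, PrefixStable (fun j => R (V j)) V k N := by
    intro k
    induction k with
    | zero => exact fun _ => ⟨0, fun j _ a ha => absurd ha (Nat.not_lt_zero _)⟩
    | succ k ih =>
      intro hk
      obtain ⟨N, hN⟩ := ih (by omega)
      exact hN.exists_succ hR hmono hV (by omega)
  obtain ⟨N, hN⟩ := hstab m le_rfl
  refine ⟨N, fun j hj => funext fun i => Equiv.ext fun c => ?_⟩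
  have hc := (hN j hj c (Fin.is_lt _)).2 i
  exact le_antisymm (position_le_of_above_imp fun a => (hc a).mp)
    (position_le_of_above_imp fun a => (hc a).mpr)
end

section
/- Let X be the set of rankings of m candidates with the swap distance, let ε be a positive integer, and let R be the Borda rule with a fixed tie-breaking order O on the candidates. Then every deliberation process converges. -/
/-- The Borda score of candidate c in the profile U: each agent placing c at
(0-indexed) position p contributes m − 1 − p points. -/
def bordaScore {m n : ℕ} (U : Fin n → Equiv.Perm (Fin m)) (c : Fin m) : ℝ :=
  ∑ i : Fin n, ((m - 1 - (U i c : ℕ) : ℕ) : ℝ)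

/-- The set of ordered pairs counted by `swapDist`. -/
def discordant {m : ℕ} (σ τ : Equiv.Perm (Fin m)) : Finset (Fin m × Fin m) :=
  Finset.univ.filter fun p => σ p.1 < σ p.2 ∧ τ p.2 < τ p.1

theorem mem_discordant {m : ℕ} {σ τ : Equiv.Perm (Fin m)} {p : Fin m × Fin m} :
    p ∈ discordant σ τ ↔ σ p.1 < σ p.2 ∧ τ p.2 < τ p.1 := by
  simp [discordant]

theorem swapDist_eq_card {m : ℕ} (σ τ : Equiv.Perm (Fin m)) :
    swapDist σ τ = (discordant σ τ).card := rfl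

theorem swapDist_le {m : ℕ} (σ τ : Equiv.Perm (Fin m)) : swapDist σ τ ≤ m * m := by
  rw [swapDist_eq_card]
  exact (Finset.card_le_univ _).trans (by simp)

theorem lt_of_lt_of_swapDist_eq_zero {m : ℕ} {σ τ : Equiv.Perm (Fin m)}
    (h : swapDist σ τ = 0) {a b : Fin m} (hab : σ a < σ b) : τ a < τ b := by
  rw [swapDist_eq_card, Finset.card_eq_zero] at h
  have hp : (a, b) ∉ discordant σ τ := by simp [h]
  rw [mem_discordant] at hp
  have hne : τ a ≠ τ b := fun e => hab.ne (congrArg σ (τ.injective e))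
  exact lt_of_le_of_ne (not_lt.1 fun hlt => hp ⟨hab, hlt⟩) hne

/-- If `σ'` lies on a geodesic from `σ` to `τ`, then every pair reversed from `σ` to `σ'`
is ordered by `σ'` as in `τ`. -/
theorem lt_of_swapDist_add_swapDist_eq {m : ℕ} {σ σ' τ : Equiv.Perm (Fin m)}
    (h : swapDist σ σ' + swapDist σ' τ = swapDist σ τ) {a b : Fin m}
    (hσ : σ b < σ a) (hσ' : σ' a < σ' b) : τ a < τ b := by
  simp only [swapDist_eq_card] at h
  have hsub : discordant σ τ ⊆ discordant σ σ' ∪ discordant σ' τ := by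
    intro p hp
    simp only [Finset.mem_union, mem_discordant] at hp ⊢
    have hne : σ' p.1 ≠ σ' p.2 := fun e => hp.1.ne (congrArg σ (σ'.injective e))
    rcases lt_or_gt_of_ne hne with hlt | hlt
    · exact Or.inr ⟨hlt, hp.2⟩
    · exact Or.inl ⟨hp.1, hlt⟩
  have heq := Finset.eq_of_subset_of_card_le hsub ((Finset.card_union_le _ _).trans h.le)
  have hmem : (b, a) ∈ discordant σ τ := by
    rw [heq]
    exact Finset.mem_union_left _ (mem_discordant.2 ⟨hσ, hσ'⟩)
  exact (mem_discordant.1 hmem).2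

theorem card_filter_apply_lt {m : ℕ} (σ : Equiv.Perm (Fin m)) (c : Fin m) :
    (Finset.univ.filter fun b => σ b < σ c).card = (σ c : ℕ) := by
  rw [← Fin.card_Iio (σ c)]
  exact Finset.card_equiv σ fun b => by simp

theorem card_filter_lt_apply {m : ℕ} (σ : Equiv.Perm (Fin m)) (c : Fin m) :
    (Finset.univ.filter fun b => σ c < σ b).card = m - 1 - (σ c : ℕ) := by
  rw [← Fin.card_Ioi (σ c)]
  exact Finset.card_equiv σ fun b => by simp

theorem perm_eq_of_lt_iff_lt {m : ℕ} {σ τ : Equiv.Perm (Fin m)}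
    (h : ∀ a b, σ a < σ b ↔ τ a < τ b) : σ = τ := by
  ext c
  rw [← card_filter_apply_lt, ← card_filter_apply_lt]
  simp only [h]

theorem eq_of_swapDist_eq_zero {m : ℕ} {σ τ : Equiv.Perm (Fin m)}
    (h : swapDist σ τ = 0) : σ = τ :=
  perm_eq_of_lt_iff_lt fun _ _ =>
    ⟨lt_of_lt_of_swapDist_eq_zero h, lt_of_lt_of_swapDist_eq_zero (swapDist_comm σ τ ▸ h)⟩

/-- Weighted Borda points of a single ranking, antisymmetrized over pairs of candidates. -/
theorem two_mul_sum_mul_points {m : ℕ} (σ : Equiv.Perm (Fin m)) (S : Fin m → ℝ) :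
    2 * ∑ c, S c * ((m - 1 - (σ c : ℕ) : ℕ) : ℝ) =
      ∑ a, ∑ b, (S a * (if σ a < σ b then 1 else 0) + S b * (if σ b < σ a then 1 else 0)) := by
  have h : ∑ c, S c * ((m - 1 - (σ c : ℕ) : ℕ) : ℝ) =
      ∑ a, ∑ b, S a * (if σ a < σ b then 1 else 0) := by
    refine Finset.sum_congr rfl fun c _ => ?_
    rw [← card_filter_lt_apply, ← Finset.mul_sum, Finset.sum_boole]
  simp only [Finset.sum_add_distrib]
  rw [Finset.sum_comm (f := fun a b => S b * (if σ b < σ a then (1 : ℝ) else 0)), ← h, two_mul]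

/-- Reversing only pairs that are thereby put in the order of `S` does not decrease the
`S`-weighted Borda points. -/
theorem sum_mul_points_le {m : ℕ} {σ σ' : Equiv.Perm (Fin m)} {S : Fin m → ℝ}
    (h : ∀ a b, σ b < σ a → σ' a < σ' b → S b ≤ S a) :
    ∑ c, S c * ((m - 1 - (σ c : ℕ) : ℕ) : ℝ) ≤ ∑ c, S c * ((m - 1 - (σ' c : ℕ) : ℕ) : ℝ) := by
  refine le_of_mul_le_mul_left ?_ (two_pos : (0 : ℝ) < 2)
  rw [two_mul_sum_mul_points, two_mul_sum_mul_points]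
  refine Finset.sum_le_sum fun a _ => Finset.sum_le_sum fun b _ => ?_
  rcases eq_or_ne a b with rfl | hab
  · simp
  rcases lt_or_gt_of_ne (σ.injective.ne hab) with h1 | h1 <;>
    rcases lt_or_gt_of_ne (σ'.injective.ne hab) with h2 | h2 <;>
    simp [h1, h2, h1.not_gt, h2.not_gt]
  · exact h b a h1 h2
  · exact h a b h1 h2

theorem sum_mul_bordaScore {m n : ℕ} (U : Fin n → Equiv.Perm (Fin m)) (S : Fin m → ℝ) :
    ∑ c, S c * bordaScore U c = ∑ i, ∑ c, S c * ((m - 1 - (U i c : ℕ) : ℕ) : ℝ) := by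
  simp only [bordaScore, Finset.mul_sum]
  exact Finset.sum_comm

namespace DelibProcess

variable {m n ε : ℕ} {R : (Fin n → Equiv.Perm (Fin m)) → Equiv.Perm (Fin m)}
  {V : ℕ → Fin n → Equiv.Perm (Fin m)}

theorem swapDist_succ (hV : DelibProcess (fun σ τ => (swapDist σ τ : ℝ)) R (ε : ℝ) V)
    (i : Fin n) (j : ℕ) :
    swapDist (V (j + 1) i) (R (V j)) = swapDist (V j i) (R (V j)) - ε := by
  have h := (hV i j).1
  simp only at h
  rcases le_total (swapDist (V j i) (R (V j))) ε with hle | hle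
  · have : (swapDist (V j i) (R (V j)) : ℝ) ≤ ε := by exact_mod_cast hle
    rw [max_eq_left (by linarith)] at h
    rw [Nat.sub_eq_zero_of_le hle]
    exact_mod_cast h
  · have : (ε : ℝ) ≤ swapDist (V j i) (R (V j)) := by exact_mod_cast hle
    rw [max_eq_right (by linarith), ← Nat.cast_sub hle] at h
    exact_mod_cast h

theorem lt_of_reversed (hV : DelibProcess (fun σ τ => (swapDist σ τ : ℝ)) R (ε : ℝ) V)
    (i : Fin n) (j : ℕ) {a b : Fin m} (h : V j i b < V j i a)
    (h' : V (j + 1) i a < V (j + 1) i b) : R (V j) a < R (V j) b := by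
  rcases Nat.eq_zero_or_pos (swapDist (V (j + 1) i) (R (V j))) with h0 | hpos
  · exact lt_of_lt_of_swapDist_eq_zero h0 h'
  · have hs := hV.swapDist_succ i j
    have hd : swapDist (V (j + 1) i) (V j i) = ε := by
      have h := (hV i j).2.1
      simp only [Nat.cast_pos] at h
      exact_mod_cast h hpos
    refine lt_of_swapDist_add_swapDist_eq ?_ h h'
    rw [swapDist_comm (V j i)]
    omega

/-- The sum of squared Borda scores grows by at least the squared change of the scores. -/
theorem sum_sq_add_le (hV : DelibProcess (fun σ τ => (swapDist σ τ : ℝ)) R (ε : ℝ) V)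
    (hR : ∀ U a b, R U a < R U b → bordaScore U b ≤ bordaScore U a) (j : ℕ) :
    ∑ c, bordaScore (V j) c ^ 2 + ∑ c, (bordaScore (V (j + 1)) c - bordaScore (V j) c) ^ 2 ≤
      ∑ c, bordaScore (V (j + 1)) c ^ 2 := by
  have h : ∑ c, bordaScore (V j) c * bordaScore (V j) c ≤
      ∑ c, bordaScore (V j) c * bordaScore (V (j + 1)) c := by
    rw [sum_mul_bordaScore, sum_mul_bordaScore]
    exact Finset.sum_le_sum fun i _ => sum_mul_points_le fun a b h1 h2 =>
      hR _ _ _ (hV.lt_of_reversed i j h1 h2)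
  have e : ∑ c, (bordaScore (V (j + 1)) c - bordaScore (V j) c) ^ 2 =
      ∑ c, bordaScore (V (j + 1)) c ^ 2 - 2 * ∑ c, bordaScore (V j) c * bordaScore (V (j + 1)) c
        + ∑ c, bordaScore (V j) c ^ 2 := by
    rw [Finset.mul_sum, ← Finset.sum_sub_distrib, ← Finset.sum_add_distrib]
    exact Finset.sum_congr rfl fun c _ => by ring
  simp only [← sq] at h
  linarith

theorem exists_bordaScore_const
    (hV : DelibProcess (fun σ τ => (swapDist σ τ : ℝ)) R (ε : ℝ) V)
    (hR : ∀ U a b, R U a < R U b → bordaScore U b ≤ bordaScore U a) :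
    ∃ N, ∀ j, N ≤ j → bordaScore (V j) = bordaScore (V N) := by
  obtain ⟨_, ⟨N, rfl⟩, hN⟩ := Set.exists_max_image (Set.range V)
    (fun U => ∑ c, bordaScore U c ^ 2) (Set.toFinite _) (Set.range_nonempty V)
  have hmax (j : ℕ) := hN _ (Set.mem_range_self j)
  refine ⟨N, fun j hj => ?_⟩
  induction j, hj using Nat.le_induction with
  | base => rfl
  | succ j _ ih =>
    have h := hV.sum_sq_add_le hR j
    have h' := hmax (j + 1)
    simp only [← ih] at h'
    have h0 : ∑ c, (bordaScore (V (j + 1)) c - bordaScore (V j) c) ^ 2 = 0 :=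
      le_antisymm (by linarith) (Finset.sum_nonneg fun _ _ => sq_nonneg _)
    rw [← ih]
    funext c
    have hc := (Finset.sum_eq_zero_iff_of_nonneg fun _ _ => sq_nonneg _).1 h0 c (Finset.mem_univ c)
    exact sub_eq_zero.1 (pow_eq_zero_iff two_ne_zero |>.1 hc)

/-- A process whose winner is eventually constant converges. -/
theorem converges_of_winner_const
    (hV : DelibProcess (fun σ τ => (swapDist σ τ : ℝ)) R (ε : ℝ) V) (hε : 1 ≤ ε) {N : ℕ}
    {w : Equiv.Perm (Fin m)} (hw : ∀ j, N ≤ j → R (V j) = w) : Converges V := by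
  have hdist (i : Fin n) (k : ℕ) : swapDist (V (N + k) i) w ≤ m * m - k := by
    induction k with
    | zero => exact swapDist_le _ _
    | succ k ih =>
      have hs := hV.swapDist_succ i (N + k)
      rw [hw _ (Nat.le_add_right N k), add_assoc] at hs
      omega
  have hlim (j : ℕ) (hj : N + m * m ≤ j) : V j = fun _ => w := by
    funext i
    obtain ⟨k, rfl⟩ := Nat.exists_eq_add_of_le (le_of_add_le_left hj)
    refine eq_of_swapDist_eq_zero (Nat.le_zero.1 ((hdist i k).trans ?_))
    omega
  exact ⟨N + m * m, fun j hj => (hlim j hj).trans (hlim _ le_rfl).symm⟩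

end DelibProcess

/-- On the set of rankings of m candidates (bijections Fin m → Fin m, mapping each
candidate to its position; smaller position = ranked higher) with the swap distance,
and the Borda rule R with a fixed tie-breaking order O on the candidates (the winner
ranks a above b iff a has strictly larger Borda score, or equal Borda score and a
precedes b in O): every deliberation process (integer ε ≥ 1) converges. -/
theorem stmt18 {m n : ℕ} {ε : ℕ} (hε : 1 ≤ ε)
    (O : Equiv.Perm (Fin m))
    (R : (Fin n → Equiv.Perm (Fin m)) → Equiv.Perm (Fin m))
    (hR : ∀ (U : Fin n → Equiv.Perm (Fin m)) (a b : Fin m),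
      R U a < R U b ↔
        (bordaScore U b < bordaScore U a ∨
          (bordaScore U a = bordaScore U b ∧ O a < O b)))
    (V : ℕ → Fin n → Equiv.Perm (Fin m))
    (hV : DelibProcess (fun σ τ => (swapDist σ τ : ℝ)) R (ε : ℝ) V) :
    Converges V := by
  obtain ⟨N, hN⟩ := hV.exists_bordaScore_const fun U a b hab =>
    ((hR U a b).1 hab).elim le_of_lt fun h => h.1.ge
  refine hV.converges_of_winner_const hε (N := N) (w := R (V N)) fun j hj =>
    perm_eq_of_lt_iff_lt fun a b => ?_
  rw [hR, hR, hN j hj]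
end
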